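/- Let k ≥ 1 and ℓ ≥ 1 be integers and let S = H^k T^ℓ (k heads followed by ℓ tails). Then for every integer n ≥ 1, E(Y^n) = ∑_{π ∈ Π_n} (−1)^{n−|π|} · |π|! · ∏_{B ∈ π} ((k+ℓ)^{|B|} − (k+ℓ−1)^{|B|}) / (p^k (1−p)^ℓ), where Π_n is the set of all partitions of the set {1, …, n}, |π| is the number of blocks of π, and |B| is the size of a block B. -/

import Mathlib

/-- The probability of a given sequence of coin flips, where `true` stands for heads
(probability `p`) and `false` for tails (probability `1 - p`). -/
def coinP (p : ℝ) (w : List Bool) : ℝ := (w.map fun b => if b then p else 1 - p).prod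

/-- The number of occurrences of `S` as a factor (consecutive substring) of `w`. -/
def numOccs (S w : List Bool) : ℕ :=
  ((Finset.range (w.length + 1)).filter fun i => (w.drop i).take S.length = S).card

/-- `coinZ S` is the set of finite binary strings in which `S` occurs exactly once as a
factor, namely as a suffix. -/
def coinZ (S : List Bool) : Set (List Bool) := {w | S <:+ w ∧ numOccs S w = 1}

/-- The `n`-th moment `E(Y^n) = ∑_{w ∈ Z(S)} |w|^n P(w)` of the number of coin flips
needed to produce `S`. -/
noncomputable def coinE (p : ℝ) (S : List Bool) (n : ℕ) : ℝ :=
  ∑' w : coinZ S, (w.1.length : ℝ) ^ n * coinP p w.1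

/-- The set of all partitions of `{1, …, n}` (modeled as `Fin n`), each partition being
the finite set of its blocks: nonempty pairwise disjoint subsets covering `Fin n`
(every element lies in exactly one block). -/
noncomputable def setPartitions (n : ℕ) : Finset (Finset (Finset (Fin n))) := by
  classical
  exact Finset.univ.filter fun P =>
    (∀ B ∈ P, B.Nonempty) ∧ ∀ x : Fin n, ∃! B, B ∈ P ∧ x ∈ B

/-- The finset of binary strings of length `N`. -/
noncomputable def wordsOfLength (N : ℕ) : Finset (List Bool) :=
  (List.finite_length_eq Bool N).toFinset

lemma mem_wordsOfLength {N : ℕ} {w : List Bool} : w ∈ wordsOfLength N ↔ w.length = N := by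
  simp [wordsOfLength]

/-- The probability that `S` first occurs after exactly `N` flips. -/
noncomputable def firstProb (p : ℝ) (S : List Bool) (N : ℕ) : ℝ :=
  ∑ w ∈ wordsOfLength N, (coinZ S).indicator (coinP p) w

/-- The probability that `S` does not occur within the first `N` flips. -/
noncomputable def avoidProb (p : ℝ) (S : List Bool) (N : ℕ) : ℝ :=
  ∑ w ∈ wordsOfLength N, {w | ¬ S <:+: w}.indicator (coinP p) w

lemma coinP_append (p : ℝ) (u v : List Bool) : coinP p (u ++ v) = coinP p u * coinP p v := by
  simp [coinP]

lemma coinP_nonneg {p : ℝ} (hp : 0 ≤ p) (hp1 : p ≤ 1) (w : List Bool) : 0 ≤ coinP p w := by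
  apply List.prod_nonneg
  intro a ha
  obtain ⟨b, -, rfl⟩ := List.mem_map.1 ha
  split_ifs <;> linarith

lemma firstProb_nonneg {p : ℝ} (hp : 0 ≤ p) (hp1 : p ≤ 1) (S : List Bool) (N : ℕ) :
    0 ≤ firstProb p S N :=
  Finset.sum_nonneg fun _ _ => Set.indicator_nonneg (fun w _ => coinP_nonneg hp hp1 w) _

lemma avoidProb_nonneg {p : ℝ} (hp : 0 ≤ p) (hp1 : p ≤ 1) (S : List Bool) (N : ℕ) :
    0 ≤ avoidProb p S N :=
  Finset.sum_nonneg fun _ _ => Set.indicator_nonneg (fun w _ => coinP_nonneg hp hp1 w) _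

/-- `w ∈ coinZ S` iff `S` is a suffix of `w` and every occurrence of `S` in `w` ends at the end
of `w`. -/
lemma mem_coinZ_iff {S w : List Bool} :
    w ∈ coinZ S ↔ S <:+ w ∧ ∀ a b, w = a ++ S ++ b → b = [] := by
  refine and_congr_right fun ⟨u, hu⟩ => ?_
  subst hu
  have hmem : u.length ∈ (Finset.range ((u ++ S).length + 1)).filter
      fun i => ((u ++ S).drop i).take S.length = S := by simp
  rw [numOccs, Finset.card_eq_one]
  constructor
  · rintro ⟨i, hi⟩ a b hab
    have hamem : a.length ∈ (Finset.range ((u ++ S).length + 1)).filter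
        fun i => ((u ++ S).drop i).take S.length = S := by
      have := congrArg List.length hab
      simp only [List.length_append] at this
      rw [Finset.mem_filter, Finset.mem_range]
      refine ⟨by simp; omega, ?_⟩
      rw [hab]; simp
    rw [hi, Finset.mem_singleton] at hmem hamem
    have := congrArg List.length hab
    simp only [List.length_append] at this
    exact List.eq_nil_of_length_eq_zero (by omega)
  · intro h
    refine ⟨u.length, Finset.eq_singleton_iff_unique_mem.2 ⟨hmem, fun i hi => ?_⟩⟩
    rw [Finset.mem_filter, Finset.mem_range] at hi
    obtain ⟨hi1, hi2⟩ := hi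
    have hsplit : u ++ S = (u ++ S).take i ++ S ++ ((u ++ S).drop i).drop S.length := by
      conv_rhs => rw [List.append_assoc]
      nth_rewrite 3 [← hi2]
      rw [List.take_append_drop, List.take_append_drop]
    have hnil := h _ _ hsplit
    rw [hnil] at hsplit
    have := congrArg List.length hsplit
    simp only [List.length_append, List.length_take, List.length_nil] at this hi1
    omega

lemma isInfix_concat_iff {S w : List Bool} {b : Bool} :
    S <:+: w ++ [b] ↔ S <:+: w ∨ S <:+ w ++ [b] := by
  constructor
  · rintro ⟨a, c, h⟩
    rcases List.eq_nil_or_concat c with rfl | ⟨c', x, rfl⟩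
    · exact Or.inr ⟨a, by simpa using h⟩
    · left
      rw [List.concat_eq_append, ← List.append_assoc] at h
      exact ⟨a, c', (List.append_inj' h rfl).1⟩
  · rintro (h | h)
    · exact h.trans (List.prefix_append _ _).isInfix
    · exact h.isInfix

lemma concat_mem_coinZ_iff {S w : List Bool} {b : Bool} :
    w ++ [b] ∈ coinZ S ↔ S <:+ w ++ [b] ∧ ¬ S <:+: w := by
  rw [mem_coinZ_iff]
  refine and_congr_right fun _ => ⟨?_, ?_⟩
  · rintro h ⟨a, c, rfl⟩
    simpa using h a (c ++ [b]) (by simp)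
  · intro h a c hac
    rcases List.eq_nil_or_concat c with rfl | ⟨c', x, rfl⟩
    · rfl
    · rw [List.concat_eq_append, ← List.append_assoc] at hac
      exact absurd ⟨a, c', (List.append_inj' hac rfl).1.symm⟩ h

lemma sum_wordsOfLength_succ (F : List Bool → ℝ) (N : ℕ) :
    ∑ w ∈ wordsOfLength (N + 1), F w = ∑ w ∈ wordsOfLength N, ∑ b : Bool, F (w ++ [b]) := by
  rw [← Finset.sum_product']
  symm
  refine Finset.sum_nbij (fun x => x.1 ++ [x.2]) ?_ ?_ ?_ (fun _ _ => rfl)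
  · simp [mem_wordsOfLength]
  · rintro ⟨u, b⟩ - ⟨v, c⟩ - h
    have := List.append_inj' h rfl
    simp_all
  · intro w hw
    have hw' : w.length = N + 1 := mem_wordsOfLength.1 hw
    rcases List.eq_nil_or_concat w with rfl | ⟨u, b, rfl⟩
    · simp at hw'
    · refine ⟨(u, b), ?_, by simp⟩
      simpa [mem_wordsOfLength] using hw'

lemma avoidProb_eq_add (p : ℝ) (S : List Bool) (N : ℕ) :
    avoidProb p S N = avoidProb p S (N + 1) + firstProb p S (N + 1) := by
  rw [avoidProb, avoidProb, firstProb, ← Finset.sum_add_distrib, sum_wordsOfLength_succ]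
  refine Finset.sum_congr rfl fun w _ => ?_
  have key : ∀ b, {w | ¬ S <:+: w}.indicator (coinP p) (w ++ [b]) +
      (coinZ S).indicator (coinP p) (w ++ [b]) =
      {w | ¬ S <:+: w}.indicator (coinP p) w * coinP p [b] := by
    intro b
    classical
    simp only [Set.indicator_apply, concat_mem_coinZ_iff, Set.mem_ofPred_eq, isInfix_concat_iff,
      coinP_append]
    by_cases h1 : S <:+: w <;> by_cases h2 : S <:+ w ++ [b] <;> simp [h1, h2]
  simp only [key, ← Finset.mul_sum]
  simp [coinP]

lemma avoidProb_zero (p : ℝ) {S : List Bool} (hS : S ≠ []) : avoidProb p S 0 = 1 := by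
  have : wordsOfLength 0 = {[]} := by
    ext w; simp [mem_wordsOfLength]
  simp [avoidProb, this, hS, coinP]

lemma firstProb_eq_zero (p : ℝ) {S : List Bool} {N : ℕ} (hN : N < S.length) :
    firstProb p S N = 0 := by
  refine Finset.sum_eq_zero fun w hw => Set.indicator_of_notMem (fun h => ?_) _
  have := h.1.length_le
  rw [mem_wordsOfLength] at hw
  omega

/-- A string `H^k T^ℓ` has no nontrivial overlap with itself. -/
lemma append_mem_coinZ_iff {k l : ℕ} (hk : 1 ≤ k) (hl : 1 ≤ l) (u : List Bool) :
    u ++ (List.replicate k true ++ List.replicate l false) ∈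
      coinZ (List.replicate k true ++ List.replicate l false) ↔
    ¬ (List.replicate k true ++ List.replicate l false) <:+: u := by
  set S := List.replicate k true ++ List.replicate l false with hS
  have hlen : S.length = k + l := by simp [hS]
  have hget : ∀ i, i < k + l → S[i]? = some (decide (i < k)) := by
    intro i hi
    rw [hS, List.getElem?_append]
    split_ifs with h <;> rw [List.length_replicate] at h <;> simp [List.getElem?_replicate] <;>
      omega
  rw [mem_coinZ_iff]
  constructor
  · rintro ⟨-, h⟩ ⟨a, b, rfl⟩
    have := congrArg List.length (h a (b ++ S) (by simp))
    simp only [List.length_append, List.length_nil, hlen] at this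
    omega
  · refine fun h => ⟨List.suffix_append _ _, fun a b hab => ?_⟩
    by_contra hb
    have hbpos := List.length_pos_iff.2 hb
    have hlen' := congrArg List.length hab
    simp only [List.length_append] at hlen'
    by_cases hbl : S.length ≤ b.length
    · rw [List.append_eq_append_iff] at hab
      rcases hab with ⟨c, h1, h2⟩ | ⟨c, h1, h2⟩
      · have h3 := congrArg List.length h1
        have h4 := congrArg List.length h2
        simp only [List.length_append] at h3 h4
        have : c = [] := List.eq_nil_of_length_eq_zero (by omega)
        subst this
        exact h ⟨a, [], by simp at h1; simp [h1]⟩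
      · exact h ⟨a, c, h1.symm⟩
    · have hshift : ∀ j, b.length + j < k + l → S[j]? = S[b.length + j]? := by
        intro j hj
        have h1 : (u ++ S)[u.length + j]? = S[j]? := by
          rw [List.getElem?_append_right (by omega), Nat.add_sub_cancel_left]
        have h2 : (a ++ S ++ b)[a.length + (b.length + j)]? = S[b.length + j]? := by
          rw [List.append_assoc, List.getElem?_append_right (by omega),
            List.getElem?_append_left (by omega)]
          simp
        rw [← h1, ← h2, hab]
        congr 1
        omega
      have h0 := hshift 0 (by omega)
      rw [hget _ (by omega), hget _ (by omega)] at h0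
      have hbk : b.length < k := by simpa [show 0 < k by omega] using h0
      have h1 := hshift (k - b.length) (by omega)
      rw [hget _ (by omega), hget _ (by omega)] at h1
      have h2 := decide_eq_decide.1 (Option.some.inj h1)
      omega

lemma firstProb_add_length (p : ℝ) {k l : ℕ} (hk : 1 ≤ k) (hl : 1 ≤ l) (N : ℕ) :
    firstProb p (List.replicate k true ++ List.replicate l false) (N + (k + l)) =
      p ^ k * (1 - p) ^ l *
        avoidProb p (List.replicate k true ++ List.replicate l false) N := by
  set S := List.replicate k true ++ List.replicate l false with hS
  have hlen : S.length = k + l := by simp [hS]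
  have hP : coinP p S = p ^ k * (1 - p) ^ l := by simp [hS, coinP]
  rw [avoidProb, firstProb, Finset.mul_sum]
  symm
  refine Finset.sum_of_injOn (· ++ S) ?_ ?_ ?_ ?_
  · exact fun u _ v _ h => List.append_cancel_right h
  · intro u hu
    have : u.length = N := mem_wordsOfLength.1 hu
    simp [mem_wordsOfLength, this, hlen]
  · intro w hw hw'
    refine Set.indicator_of_notMem (fun h => hw' ?_) _
    obtain ⟨u, rfl⟩ := h.1
    refine ⟨u, ?_, rfl⟩
    rw [mem_wordsOfLength, List.length_append, hlen] at hw
    exact mem_wordsOfLength.2 (by omega)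
  · intro u _
    classical
    simp only [Set.indicator_apply, hS, append_mem_coinZ_iff hk hl, Set.mem_ofPred_eq]
    rw [← hS, coinP_append, hP]
    split_ifs <;> ring

lemma avoidProb_antitone {p : ℝ} (hp : 0 ≤ p) (hp1 : p ≤ 1) (S : List Bool) :
    Antitone (avoidProb p S) :=
  antitone_nat_of_succ_le fun N => by
    have := avoidProb_eq_add p S N
    have := firstProb_nonneg hp hp1 S (N + 1)
    linarith

lemma summable_pow_mul_avoidProb {p : ℝ} (hp : 0 < p) (hp1 : p < 1) {k l : ℕ} (hk : 1 ≤ k)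
    (hl : 1 ≤ l) (n : ℕ) :
    Summable fun N : ℕ =>
      (N : ℝ) ^ n * avoidProb p (List.replicate k true ++ List.replicate l false) N := by
  set S := List.replicate k true ++ List.replicate l false with hS
  set c := p ^ k * (1 - p) ^ l with hc
  have hSne : S ≠ [] := by
    intro h
    have := congrArg List.length h
    simp [hS] at this
    omega
  have hq : 0 < 1 - p := by linarith
  have hc0 : 0 < c := by positivity
  have hc1 : c < 1 := by
    calc c < 1 * 1 := mul_lt_mul' (pow_le_one₀ hp.le hp1.le)
          (pow_lt_one₀ hq.le (by linarith) (by omega)) (by positivity) one_pos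
      _ = 1 := one_mul 1
  have hstep : ∀ N, avoidProb p S (N + (k + l)) ≤ (1 - c) * avoidProb p S N := by
    intro N
    have h1 := avoidProb_eq_add p S (N + (k + l - 1))
    rw [show N + (k + l - 1) + 1 = N + (k + l) by omega, firstProb_add_length p hk hl N] at h1
    have h2 := avoidProb_antitone hp.le hp1.le S (show N ≤ N + (k + l - 1) by omega)
    linarith
  set r : ℝ := (1 - c) ^ ((k + l : ℕ) : ℝ)⁻¹ with hr
  have hr0 : 0 < r := Real.rpow_pos_of_pos (by linarith) _
  have hr1 : r < 1 := Real.rpow_lt_one (by linarith) (by linarith) (by positivity)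
  have hrm : r ^ (k + l) = 1 - c := Real.rpow_inv_natCast_pow (by linarith) (by omega)
  have hle : ∀ N, avoidProb p S N ≤ (r ^ (k + l))⁻¹ * r ^ N := by
    intro N
    induction N using Nat.strong_induction_on with
    | _ N ih =>
      by_cases hN : N < k + l
      · have h1 := avoidProb_antitone hp.le hp1.le S (Nat.zero_le N)
        rw [avoidProb_zero p hSne] at h1
        refine h1.trans ?_
        rw [inv_mul_eq_div, one_le_div (by positivity)]
        exact pow_le_pow_of_le_one hr0.le hr1.le hN.le
      · obtain ⟨M, rfl⟩ : ∃ M, N = M + (k + l) := ⟨N - (k + l), by omega⟩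
        have h1 := ih M (by omega)
        refine (hstep M).trans ?_
        calc (1 - c) * avoidProb p S M ≤ (1 - c) * ((r ^ (k + l))⁻¹ * r ^ M) :=
              mul_le_mul_of_nonneg_left h1 (by linarith)
          _ = (r ^ (k + l))⁻¹ * r ^ (M + (k + l)) := by rw [← hrm, pow_add r M]; ring
  refine Summable.of_nonneg_of_le (fun N => mul_nonneg (by positivity)
    (avoidProb_nonneg hp.le hp1.le S N)) (fun N => ?_)
    ((summable_pow_mul_geometric_of_norm_lt_one n (r := r)
      (by rwa [Real.norm_of_nonneg hr0.le])).mul_left (r ^ (k + l))⁻¹)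
  calc (N : ℝ) ^ n * avoidProb p S N ≤ (N : ℝ) ^ n * ((r ^ (k + l))⁻¹ * r ^ N) := by
        gcongr; exact hle N
    _ = _ := by ring

lemma firstProb_zero (p : ℝ) {S : List Bool} (hS : S ≠ []) : firstProb p S 0 = 0 :=
  firstProb_eq_zero p (List.length_pos_iff.2 hS)

lemma summable_pow_mul_firstProb {p : ℝ} (hp : 0 ≤ p) (hp1 : p ≤ 1) {S : List Bool} {n : ℕ}
    (h : Summable fun N : ℕ => (N + 1 : ℝ) ^ n * avoidProb p S N) :
    Summable fun N : ℕ => (N : ℝ) ^ n * firstProb p S N := by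
  rw [← summable_nat_add_iff 1]
  refine Summable.of_nonneg_of_le (fun N => mul_nonneg (by positivity)
    (firstProb_nonneg hp hp1 S _)) (fun N => ?_) h
  push_cast
  have := avoidProb_eq_add p S N
  have := avoidProb_nonneg hp hp1 S (N + 1)
  gcongr
  linarith

lemma coinE_eq_tsum {p : ℝ} (hp : 0 ≤ p) (hp1 : p ≤ 1) {S : List Bool} {n : ℕ}
    (h : Summable fun N : ℕ => (N : ℝ) ^ n * firstProb p S N) :
    coinE p S n = ∑' N : ℕ, (N : ℝ) ^ n * firstProb p S N := by
  set F : List Bool → ℝ := (coinZ S).indicator fun w => (w.length : ℝ) ^ n * coinP p w with hF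
  have hFnonneg : ∀ w, 0 ≤ F w := fun w =>
    Set.indicator_nonneg (fun w _ => mul_nonneg (by positivity) (coinP_nonneg hp hp1 w)) _
  have hfib : ∀ N, ∑' w : {w : List Bool // w.length = N}, F w =
      (N : ℝ) ^ n * firstProb p S N := by
    intro N
    have h1 : ∑' w : {w : List Bool // w.length = N}, F w = ∑ w ∈ wordsOfLength N, F w := by
      rw [← Finset.tsum_subtype]
      refine (Equiv.subtypeEquivRight fun w => mem_wordsOfLength.symm).tsum_eq
        (fun w : {w // w ∈ wordsOfLength N} => F w)
    rw [h1, firstProb, Finset.mul_sum]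
    refine Finset.sum_congr rfl fun w hw => ?_
    rw [mem_wordsOfLength] at hw
    classical
    simp only [hF, Set.indicator_apply, hw]
    split_ifs <;> simp
  have hfin : ∀ N, Summable fun w : {w : List Bool // w.length = N} => F w := by
    intro N
    have : Finite {w : List Bool // w.length = N} := (List.finite_length_eq Bool N).to_subtype
    exact Summable.of_finite
  rw [coinE, tsum_subtype (coinZ S) fun w => (w.length : ℝ) ^ n * coinP p w, ← hF,
    ← (Equiv.sigmaFiberEquiv List.length).tsum_eq F]
  have hs : Summable fun x : Σ N, {w : List Bool // w.length = N} => F x.2 := by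
    rw [summable_sigma_of_nonneg fun x => hFnonneg _]
    exact ⟨hfin, by simpa only [hfib] using h⟩
  exact (hs.tsum_sigma' hfin).trans (tsum_congr hfib)

lemma tsum_pow_mul_firstProb {p : ℝ} {S : List Bool} (hS : S ≠ []) {n : ℕ}
    (h1 : Summable fun N : ℕ => (N : ℝ) ^ n * avoidProb p S N)
    (h2 : Summable fun N : ℕ => (N + 1 : ℝ) ^ n * avoidProb p S N)
    (h3 : Summable fun N : ℕ => (N : ℝ) ^ n * firstProb p S N) :
    ∑' N : ℕ, (N : ℝ) ^ n * firstProb p S N =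
      0 ^ n + ∑' N : ℕ, ((N + 1 : ℝ) ^ n - (N : ℝ) ^ n) * avoidProb p S N := by
  have e1 : ∑' N : ℕ, (N : ℝ) ^ n * firstProb p S N =
      ∑' N : ℕ, (N + 1 : ℝ) ^ n * firstProb p S (N + 1) := by
    rw [h3.tsum_eq_zero_add, firstProb_zero p hS]
    push_cast
    ring
  have h1' := (summable_nat_add_iff 1).2 h1
  have e2 := h1.tsum_eq_zero_add
  rw [avoidProb_zero p hS] at e2
  push_cast at h1' e2
  simp only [sub_mul]
  rw [h2.tsum_sub h1, e2, e1]
  have : ∀ N : ℕ, (N + 1 : ℝ) ^ n * firstProb p S (N + 1) =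
      (N + 1 : ℝ) ^ n * avoidProb p S N - (N + 1 : ℝ) ^ n * avoidProb p S (N + 1) := by
    intro N
    rw [avoidProb_eq_add p S N]
    ring
  simp only [this]
  rw [h2.tsum_sub h1']
  ring

open Classical in
/-- The set partitions of a finset `A`, each given as the finset of its blocks. -/
noncomputable def partitionsOf {α : Type*} (A : Finset α) : Finset (Finset (Finset α)) :=
  A.powerset.powerset.filter fun P => (∀ B ∈ P, B.Nonempty) ∧ (∀ x ∈ A, ∃ B ∈ P, x ∈ B) ∧
    ∀ B ∈ P, ∀ C ∈ P, ∀ x, x ∈ B → x ∈ C → B = C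

lemma mem_partitionsOf {α : Type*} {A : Finset α} {P : Finset (Finset α)} :
    P ∈ partitionsOf A ↔ (∀ B ∈ P, B ⊆ A) ∧ (∀ B ∈ P, B.Nonempty) ∧
      (∀ x ∈ A, ∃ B ∈ P, x ∈ B) ∧ ∀ B ∈ P, ∀ C ∈ P, ∀ x, x ∈ B → x ∈ C → B = C := by
  simp only [partitionsOf, Finset.mem_filter, Finset.mem_powerset]
  refine and_congr_left fun _ => ?_
  simp [Finset.subset_iff]

lemma setPartitions_eq (n : ℕ) : setPartitions n = partitionsOf Finset.univ := by
  ext P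
  rw [mem_partitionsOf]
  simp only [setPartitions, Finset.mem_filter, Finset.mem_univ, true_and, Finset.subset_univ,
    implies_true, true_imp_iff]
  refine and_congr_right fun _ => ⟨fun h => ⟨fun x => ?_, fun B hB C hC x hxB hxC => ?_⟩,
    fun ⟨h1, h2⟩ x => ?_⟩
  · obtain ⟨B, hB, -⟩ := h x
    exact ⟨B, hB⟩
  · exact (h x).unique ⟨hB, hxB⟩ ⟨hC, hxC⟩
  · obtain ⟨B, hB, hxB⟩ := h1 x
    exact ⟨B, ⟨hB, hxB⟩, fun C hC => h2 C hC.1 B hB x hC.2 hxB⟩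

lemma sum_card_of_mem_partitionsOf {α : Type*} {A : Finset α} {P : Finset (Finset α)}
    (hP : P ∈ partitionsOf A) : ∑ B ∈ P, B.card = A.card := by
  classical
  obtain ⟨h1, -, h3, h4⟩ := mem_partitionsOf.1 hP
  have hA : A = P.biUnion id := by
    ext x
    rw [Finset.mem_biUnion]
    exact ⟨h3 x, fun ⟨B, hB, hx⟩ => h1 B hB hx⟩
  rw [hA, Finset.card_biUnion]
  · rfl
  · intro B hB C hC hBC
    exact Finset.disjoint_left.2 fun x hxB hxC => hBC (h4 B hB C hC x hxB hxC)

lemma card_le_of_mem_partitionsOf {α : Type*} {A : Finset α} {P : Finset (Finset α)}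
    (hP : P ∈ partitionsOf A) : P.card ≤ A.card := by
  rw [← sum_card_of_mem_partitionsOf hP, Finset.card_eq_sum_ones]
  exact Finset.sum_le_sum fun B hB => Finset.card_pos.2 ((mem_partitionsOf.1 hP).2.1 B hB)

/-- The sum over all ordered set partitions of `A` of the products of the block weights. -/
noncomputable def orderedPartitionSum {α : Type*} (v : ℕ → ℝ) (A : Finset α) : ℝ :=
  ∑ P ∈ partitionsOf A, (P.card.factorial : ℝ) * ∏ B ∈ P, v B.card

lemma orderedPartitionSum_empty {α : Type*} (v : ℕ → ℝ) :
    orderedPartitionSum v (∅ : Finset α) = 1 := by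
  have : partitionsOf (∅ : Finset α) = {∅} := by
    ext P
    rw [mem_partitionsOf, Finset.mem_singleton]
    constructor
    · rintro ⟨h1, h2, -⟩
      refine Finset.eq_empty_of_forall_notMem fun B hB => ?_
      exact (h2 B hB).ne_empty (Finset.subset_empty.1 (h1 B hB))
    · rintro rfl
      simp
  simp [orderedPartitionSum, this]

/-- Conditioning on the first block of an ordered set partition. -/
lemma orderedPartitionSum_eq_sum {α : Type*} [DecidableEq α] {v : ℕ → ℝ} (hv : v 0 = 0)
    {A : Finset α} (hA : A.Nonempty) :
    orderedPartitionSum v A =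
      ∑ B ∈ A.powerset, v B.card * orderedPartitionSum v (A \ B) := by
  have hleft : orderedPartitionSum v A = ∑ P ∈ partitionsOf A, ∑ _B ∈ P,
      ((P.card - 1).factorial : ℝ) * ∏ C ∈ P, v C.card := by
    refine Finset.sum_congr rfl fun P hP => ?_
    have hpos : P.card ≠ 0 := by
      obtain ⟨x, hx⟩ := hA
      obtain ⟨B, hB, -⟩ := (mem_partitionsOf.1 hP).2.2.1 x hx
      exact Finset.card_ne_zero_of_mem hB
    rw [Finset.sum_const, nsmul_eq_mul, ← Nat.mul_factorial_pred hpos]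
    push_cast
    ring
  have hright : ∑ B ∈ A.powerset, v B.card * orderedPartitionSum v (A \ B) =
      ∑ B ∈ A.powerset.filter Finset.Nonempty, ∑ P ∈ partitionsOf (A \ B),
        v B.card * ((P.card.factorial : ℝ) * ∏ C ∈ P, v C.card) := by
    rw [Finset.sum_filter]
    refine Finset.sum_congr rfl fun B _ => ?_
    split_ifs with hB
    · rw [orderedPartitionSum, Finset.mul_sum]
    · rw [Finset.not_nonempty_iff_eq_empty.1 hB, Finset.card_empty, hv, zero_mul]
  have hnotMem : ∀ {B : Finset α} {P : Finset (Finset α)}, B.Nonempty →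
      P ∈ partitionsOf (A \ B) → B ∉ P := by
    intro B P ⟨x, hx⟩ hP hBP
    exact (Finset.mem_sdiff.1 ((mem_partitionsOf.1 hP).1 B hBP hx)).2 hx
  rw [hleft, hright, Finset.sum_sigma', Finset.sum_sigma']
  refine Finset.sum_bij' (fun x _ => ⟨x.2, x.1.erase x.2⟩) (fun x _ => ⟨insert x.1 x.2, x.1⟩)
    ?_ ?_ ?_ ?_ ?_
  · rintro ⟨P, B⟩ h
    simp only [Finset.mem_sigma, mem_partitionsOf, Finset.mem_filter, Finset.mem_powerset] at h ⊢
    obtain ⟨⟨h1, h2, h3, h4⟩, hB⟩ := h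
    refine ⟨⟨h1 B hB, h2 B hB⟩, ?_, ?_, ?_, ?_⟩
    · intro C hC x hx
      have hCP := Finset.mem_of_mem_erase hC
      refine Finset.mem_sdiff.2 ⟨h1 C hCP hx, fun hxB => ?_⟩
      exact Finset.ne_of_mem_erase hC (h4 C hCP B hB x hx hxB)
    · exact fun C hC => h2 C (Finset.mem_of_mem_erase hC)
    · intro x hx
      obtain ⟨hxA, hxB⟩ := Finset.mem_sdiff.1 hx
      obtain ⟨C, hC, hxC⟩ := h3 x hxA
      exact ⟨C, Finset.mem_erase.2 ⟨fun h => hxB (h ▸ hxC), hC⟩, hxC⟩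
    · exact fun C hC D hD => h4 C (Finset.mem_of_mem_erase hC) D (Finset.mem_of_mem_erase hD)
  · rintro ⟨B, P⟩ h
    simp only [Finset.mem_sigma, mem_partitionsOf, Finset.mem_filter, Finset.mem_powerset] at h ⊢
    obtain ⟨⟨hBA, hB⟩, h1, h2, h3, h4⟩ := h
    refine ⟨⟨?_, ?_, ?_, ?_⟩, Finset.mem_insert_self _ _⟩
    · intro C hC
      rcases Finset.mem_insert.1 hC with rfl | hC
      · exact hBA
      · exact (h1 C hC).trans Finset.sdiff_subset
    · intro C hC
      rcases Finset.mem_insert.1 hC with rfl | hC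
      · exact hB
      · exact h2 C hC
    · intro x hx
      by_cases hxB : x ∈ B
      · exact ⟨B, Finset.mem_insert_self _ _, hxB⟩
      · obtain ⟨C, hC, hxC⟩ := h3 x (Finset.mem_sdiff.2 ⟨hx, hxB⟩)
        exact ⟨C, Finset.mem_insert_of_mem hC, hxC⟩
    · intro C hC D hD x hxC hxD
      rcases Finset.mem_insert.1 hC with hCB | hCP <;>
        rcases Finset.mem_insert.1 hD with hDB | hDP
      · rw [hCB, hDB]
      · exact absurd (hCB ▸ hxC) (Finset.mem_sdiff.1 (h1 D hDP hxD)).2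
      · exact absurd (hDB ▸ hxD) (Finset.mem_sdiff.1 (h1 C hCP hxC)).2
      · exact h4 C hCP D hDP x hxC hxD
  · rintro ⟨P, B⟩ h
    simp [Finset.insert_erase (Finset.mem_sigma.1 h).2]
  · rintro ⟨B, P⟩ h
    obtain ⟨hB, hP⟩ := Finset.mem_sigma.1 h
    simp [Finset.erase_insert (hnotMem (Finset.mem_filter.1 hB).2 hP)]
  · rintro ⟨P, B⟩ h
    obtain ⟨-, hB⟩ := Finset.mem_sigma.1 h
    simp only
    rw [← Finset.mul_prod_erase P (fun C => v C.card) hB, Finset.card_erase_of_mem hB]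
    ring

lemma orderedPartitionSum_eq {α : Type*} {v M : ℕ → ℝ} (hv : v 0 = 0) (hM0 : M 0 = 1)
    (hM : ∀ n, 1 ≤ n → M n = ∑ j ∈ Finset.range (n + 1), n.choose j * (v j * M (n - j)))
    (A : Finset α) : orderedPartitionSum v A = M A.card := by
  classical
  induction A using Finset.strongInduction with
  | H A ih =>
    rcases A.eq_empty_or_nonempty with rfl | hA
    · rw [orderedPartitionSum_empty, Finset.card_empty, hM0]
    · rw [orderedPartitionSum_eq_sum hv hA, hM _ (Finset.card_pos.2 hA)]
      have h := Finset.sum_powerset_apply_card (x := A) (fun j => v j * M (A.card - j))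
      simp only [nsmul_eq_mul] at h
      rw [← h]
      refine Finset.sum_congr rfl fun B hB => ?_
      have hBA := Finset.mem_powerset.1 hB
      rcases B.eq_empty_or_nonempty with rfl | hBne
      · simp [hv]
      · rw [ih _ (Finset.sdiff_ssubset hBA hBne), Finset.card_sdiff_of_subset hBA]

lemma sum_partitionsOf_sign {α : Type*} (a : ℕ → ℝ) (A : Finset α) :
    ∑ P ∈ partitionsOf A, (-1 : ℝ) ^ (A.card - P.card) * (P.card.factorial : ℝ) *
        ∏ B ∈ P, a B.card =
      orderedPartitionSum (fun j => (-1) ^ (j + 1) * a j) A := by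
  refine Finset.sum_congr rfl fun P hP => ?_
  have hsum := sum_card_of_mem_partitionsOf hP
  have hle := card_le_of_mem_partitionsOf hP
  rw [Finset.prod_mul_distrib, Finset.prod_pow_eq_pow_sum, Finset.sum_add_distrib, hsum,
    ← Finset.card_eq_sum_ones]
  have : (-1 : ℝ) ^ (A.card + P.card) = (-1) ^ (A.card - P.card) := by
    rw [show A.card + P.card = A.card - P.card + 2 * P.card by omega, pow_add, pow_mul]
    simp
  rw [this]
  ring

lemma moment_recurrence {p : ℝ} (hp : 0 < p) (hp1 : p < 1) {k l : ℕ} (hk : 1 ≤ k)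
    (hl : 1 ≤ l) :
    coinE p (List.replicate k true ++ List.replicate l false) 0 = 1 ∧
    ∀ n, 1 ≤ n → coinE p (List.replicate k true ++ List.replicate l false) n =
      ∑ j ∈ Finset.range (n + 1), n.choose j * ((-1) ^ (j + 1) *
        ((((k : ℝ) + l) ^ j - ((k : ℝ) + l - 1) ^ j) / (p ^ k * (1 - p) ^ l)) *
        coinE p (List.replicate k true ++ List.replicate l false) (n - j)) := by
  set S := List.replicate k true ++ List.replicate l false with hS
  set c := p ^ k * (1 - p) ^ l with hc
  have hq : 0 < 1 - p := by linarith
  have hc0 : c ≠ 0 := by positivity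
  have hlen : S.length = k + l := by simp [hS]
  have hSne : S ≠ [] := List.length_pos_iff.1 (by omega)
  have hsg : ∀ n : ℕ, Summable fun N : ℕ => (N : ℝ) ^ n * avoidProb p S N :=
    summable_pow_mul_avoidProb hp hp1 hk hl
  have hsg1 : ∀ n : ℕ, Summable fun N : ℕ => (N + 1 : ℝ) ^ n * avoidProb p S N := by
    intro n
    have : Summable fun N : ℕ => ∑ i ∈ Finset.range (n + 1),
        (n.choose i : ℝ) * ((N : ℝ) ^ i * avoidProb p S N) :=
      summable_sum fun i _ => (hsg i).mul_left _
    refine this.congr fun N => ?_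
    rw [add_pow, Finset.sum_mul]
    exact Finset.sum_congr rfl fun i _ => by ring
  have hsf : ∀ n : ℕ, Summable fun N : ℕ => (N : ℝ) ^ n * firstProb p S N :=
    fun n => summable_pow_mul_firstProb hp.le hp1.le (hsg1 n)
  have hE : ∀ n, coinE p S n = ∑' N : ℕ, (N : ℝ) ^ n * firstProb p S N :=
    fun n => coinE_eq_tsum hp.le hp1.le (hsf n)
  have hE' : ∀ n, coinE p S n =
      0 ^ n + ∑' N : ℕ, ((N + 1 : ℝ) ^ n - (N : ℝ) ^ n) * avoidProb p S N :=
    fun n => (hE n).trans (tsum_pow_mul_firstProb hSne (hsg n) (hsg1 n) (hsf n))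
  refine ⟨by rw [hE']; simp, fun n hn => ?_⟩
  have hterm : ∀ j ∈ Finset.range (n + 1), n.choose j * ((-1) ^ (j + 1) *
      ((((k : ℝ) + l) ^ j - ((k : ℝ) + l - 1) ^ j) / c) * coinE p S (n - j)) =
      ∑' N : ℕ, c⁻¹ * (n.choose j * ((1 - ((k : ℝ) + l)) ^ j - (-((k : ℝ) + l)) ^ j) *
        ((N : ℝ) ^ (n - j) * firstProb p S N)) := by
    intro j _
    rw [tsum_mul_left, tsum_mul_left, ← hE, ← neg_sub ((k : ℝ) + l) 1,
      neg_pow ((k : ℝ) + l - 1), neg_pow ((k : ℝ) + l)]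
    ring
  have hbinom : ∀ N : ℕ, ∑ j ∈ Finset.range (n + 1),
      c⁻¹ * (n.choose j * ((1 - ((k : ℝ) + l)) ^ j - (-((k : ℝ) + l)) ^ j) *
        ((N : ℝ) ^ (n - j) * firstProb p S N)) =
      c⁻¹ * (((1 - ((k : ℝ) + l) + N) ^ n - (-((k : ℝ) + l) + N) ^ n) * firstProb p S N) := by
    intro N
    rw [← Finset.mul_sum, add_pow, add_pow, ← Finset.sum_sub_distrib, Finset.sum_mul]
    exact congrArg _ (Finset.sum_congr rfl fun j _ => by ring)
  have hsj : ∀ j ∈ Finset.range (n + 1), Summable fun N : ℕ =>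
      c⁻¹ * (n.choose j * ((1 - ((k : ℝ) + l)) ^ j - (-((k : ℝ) + l)) ^ j) *
        ((N : ℝ) ^ (n - j) * firstProb p S N)) :=
    fun j _ => ((hsf (n - j)).mul_left _).mul_left _
  have hs := summable_sum hsj
  rw [Finset.sum_congr rfl hterm, ← Summable.tsum_finsetSum hsj]
  simp only [hbinom] at hs ⊢
  rw [← hs.sum_add_tsum_nat_add (k + l), Finset.sum_eq_zero, zero_add, hE',
    zero_pow (by omega), zero_add]
  · refine tsum_congr fun N => ?_
    rw [firstProb_add_length p hk hl N, ← hS, ← hc]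
    push_cast
    field_simp
    ring
  · intro N hN
    rw [firstProb_eq_zero p (by rw [hlen]; exact Finset.mem_range.1 hN)]
    ring

/-- For `S = H^k T^ℓ`:
`E(Y^n) = ∑_{π ∈ Π_n} (-1)^{n-|π|} |π|! ∏_{B ∈ π} ((k+ℓ)^{|B|} - (k+ℓ-1)^{|B|})/(p^k (1-p)^ℓ)`. -/
theorem stmt_19 (p : ℝ) (hp : 0 < p) (hp1 : p < 1) (k l : ℕ) (hk : 1 ≤ k) (hl : 1 ≤ l)
    (n : ℕ) (hn : 1 ≤ n) :
    coinE p (List.replicate k true ++ List.replicate l false) n =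
      ∑ π ∈ setPartitions n, (-1 : ℝ) ^ (n - π.card) * (π.card.factorial : ℝ) *
        ∏ B ∈ π,
          (((k : ℝ) + l) ^ B.card - ((k : ℝ) + l - 1) ^ B.card) / (p ^ k * (1 - p) ^ l) := by
  have hrec := moment_recurrence hp hp1 hk hl
  have hsign := sum_partitionsOf_sign
    (fun j => (((k : ℝ) + l) ^ j - ((k : ℝ) + l - 1) ^ j) / (p ^ k * (1 - p) ^ l))
    (Finset.univ : Finset (Fin n))
  rw [orderedPartitionSum_eq (by simp) hrec.1 hrec.2, Finset.card_univ, Fintype.card_fin] at hsign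
  rw [setPartitions_eq, ← hsign]
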